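/- Let V be a nonlocal vertex algebra and let S(x) be a unitary rational quantum Yang–Baxter operator on V. Then: (1) S(x)(1⊗v) = 1⊗v for all v ∈ V if and only if S(x)(v⊗1) = v⊗1 for all v ∈ V; (2) [D⊗1, S(x)] = −(d/dx)S(x) if and only if [1⊗D, S⁻¹(x)] = (d/dx)S⁻¹(x); (3) S(x₁)(Y(x₂)⊗1) = (Y(x₂)⊗1)S²³(x₁)S¹³(x₁+x₂) if and only if S(x₁)(1⊗Y(x₂)) = (1⊗Y(x₂))S¹²(x₁−x₂)S¹³(x₁). -/

import Mathlib

open scoped TensorProduct BigOperators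

noncomputable section

/-- Integer binomial coefficient `C(n, k)` for `n : ℤ`, `k : ℕ`. -/
def zchoose (n : ℤ) (k : ℕ) : ℤ :=
  if 0 ≤ n then ((n.toNat).choose k : ℤ)
  else (-1) ^ k * ((((k : ℤ) - n - 1).toNat).choose k)

section Series

variable {V : Type*} [AddCommGroup V] [Module ℂ V]

/-- `a` is (the coefficient family of) an element of `V((x))`. -/
def IsLaurent (a : ℤ → V) : Prop := ∃ N : ℤ, ∀ n : ℤ, n < N → a n = 0

/-- `a` is an element of `V[[x]]`. -/
def IsPowerSeries (a : ℤ → V) : Prop := ∀ n : ℤ, n < 0 → a n = 0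

/-- `A` is an element of `V((x₁, x₂))` (first index: exponent of `x₁`). -/
def IsLaurent2 (A : ℤ → ℤ → V) : Prop :=
  ∃ N : ℤ, ∀ m n : ℤ, (m < N ∨ n < N) → A m n = 0

/-- `a` is an element of `V ⊗ ℂ((x)) ⊆ V((x))`: truncated below, with coefficients
lying in a finitely generated (i.e. finite dimensional) subspace. -/
def IsTensorLaurent (a : ℤ → V) : Prop :=
  IsLaurent a ∧ ∃ F : Submodule ℂ V, F.FG ∧ ∀ n, a n ∈ F

/-- Multiply the double series `A(x₁,x₂)` by `(x₁+x₂)^k`. -/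
def mulAddPow (k : ℕ) (A : ℤ → ℤ → V) : ℤ → ℤ → V := fun a b =>
  ∑ j ∈ Finset.range (k + 1), ((k.choose j : ℕ) : ℂ) • A (a - (k : ℤ) + j) (b - j)

/-- Multiply the double series `A(x₁,x₂)` by `(x₁-x₂)^k`. -/
def mulSubPow (k : ℕ) (A : ℤ → ℤ → V) : ℤ → ℤ → V := fun a b =>
  ∑ j ∈ Finset.range (k + 1),
    ((-1 : ℂ) ^ j * ((k.choose j : ℕ) : ℂ)) • A (a - (k : ℤ) + j) (b - j)

/-- Multiply the double series `A(x₁,x₂)` by `(x₂-x₁)^k`. -/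
def mulSubPow' (k : ℕ) (A : ℤ → ℤ → V) : ℤ → ℤ → V := fun a b =>
  ∑ j ∈ Finset.range (k + 1),
    ((-1 : ℂ) ^ j * ((k.choose j : ℕ) : ℂ)) • A (a - j) (b - (k : ℤ) + j)

/-- Substitute `x₁ = x₀ + x₂` in `A(x₁,x₂)`, expanding in nonnegative powers of `x₂`.
The result is indexed by (exponent of `x₀`, exponent of `x₂`). -/
def substAdd02 (A : ℤ → ℤ → V) : ℤ → ℤ → V := fun a b =>
  ∑ᶠ i : ℕ, ((zchoose (a + i) i : ℤ) : ℂ) • A (a + i) (b - i)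

/-- Substitute `x₁ = x₂ + x₀` in `A(x₁,x₂)`, expanding in nonnegative powers of `x₀`.
The result is indexed by (exponent of `x₀`, exponent of `x₂`). -/
def substAdd20 (A : ℤ → ℤ → V) : ℤ → ℤ → V := fun a b =>
  if 0 ≤ a then ∑ᶠ m : ℤ, ((zchoose m a.toNat : ℤ) : ℂ) • A m (b - m + a) else 0

/-- Multiply the double series `A(x₁,x₂)` by `f(x₂ - x₁)`, expanded in nonnegative
powers of `x₁`. -/
def scalarMulSub (f : ℤ → ℂ) (A : ℤ → ℤ → V) : ℤ → ℤ → V := fun m n =>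
  ∑ᶠ (i : ℕ) (p : ℤ),
    ((-1 : ℂ) ^ i * ((zchoose p i : ℤ) : ℂ) * f p) • A (m - i) (n - p + i)

/-- Multiply a double series by a polynomial in two variables. -/
def polyMul2 (p : MvPolynomial (Fin 2) ℂ) (A : ℤ → ℤ → V) : ℤ → ℤ → V := fun m n =>
  ∑ d ∈ p.support, MvPolynomial.coeff d p • A (m - (d 0 : ℤ)) (n - (d 1 : ℤ))

/-- The relation `A ∼ B`: `p·A = p·B` for some nonzero polynomial `p(x₁,x₂)`. -/
def SimEq2 (A B : ℤ → ℤ → V) : Prop :=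
  ∃ p : MvPolynomial (Fin 2) ℂ, p ≠ 0 ∧ ∀ m n : ℤ, polyMul2 p A m n = polyMul2 p B m n

/-- `a` is an element of the iterated Laurent series space `V((x₁))⋯((x_n))`. -/
def IsIterLaurent : (n : ℕ) → ((Fin n → ℤ) → V) → Prop
  | 0, _ => True
  | n + 1, a =>
      (∃ N : ℤ, ∀ k : Fin (n + 1) → ℤ, k (Fin.last n) < N → a k = 0) ∧
      ∀ m : ℤ, IsIterLaurent n fun k => a (Fin.snoc k m)

end Series

/-- A nonlocal vertex algebra over `ℂ`, with `Y u v n` the coefficient of `x^n`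
in `Y(u,x)v` (so `u_m v = Y u v (-m-1)`). -/
structure NLVA (V : Type*) [AddCommGroup V] [Module ℂ V] where
  Y : V →ₗ[ℂ] V →ₗ[ℂ] (ℤ → V)
  one : V
  trunc : ∀ u v : V, IsLaurent (Y u v)
  vacuum_left : ∀ (v : V) (n : ℤ), Y one v n = if n = 0 then v else 0
  creation_reg : ∀ v : V, IsPowerSeries (Y v one)
  creation_zero : ∀ v : V, Y v one 0 = v
  weak_assoc : ∀ u v w : V, ∃ k : ℕ, ∀ a b : ℤ,
    mulAddPow k (substAdd02 fun m n => Y u (Y v w n) m) a b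
      = mulAddPow k (fun a' b' => Y (Y u v a') w b') a b

namespace NLVA

variable {U V K : Type*} [AddCommGroup U] [Module ℂ U] [AddCommGroup V] [Module ℂ V]
  [AddCommGroup K] [Module ℂ K]

/-- The coefficient `Y(·)_n(·)` as a bilinear map. -/
def Yc (𝒱 : NLVA V) (n : ℤ) : V →ₗ[ℂ] V →ₗ[ℂ] V :=
  𝒱.Y.compr₂ (LinearMap.proj n)

/-- The operator `D(v) = v_{-2}𝟙`, i.e. the coefficient of `x^1` in `Y(v,x)𝟙`. -/
def D (𝒱 : NLVA V) : V →ₗ[ℂ] V :=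
  (LinearMap.proj (1 : ℤ)).comp (𝒱.Y.flip 𝒱.one)

/-- Homomorphisms of nonlocal vertex algebras. -/
def IsHom (𝒰 : NLVA U) (𝒱 : NLVA V) (f : U →ₗ[ℂ] V) : Prop :=
  f 𝒰.one = 𝒱.one ∧ ∀ (a b : U) (n : ℤ), f (𝒰.Y a b n) = 𝒱.Y (f a) (f b) n

/-- `𝒦` is generated, as a nonlocal vertex algebra, by the subset `S`. -/
def IsGeneratedBy (𝒦 : NLVA K) (S : Set K) : Prop :=
  ∀ P : Submodule ℂ K, 𝒦.one ∈ P →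
    (∀ a ∈ P, ∀ b ∈ P, ∀ n : ℤ, 𝒦.Y a b n ∈ P) → S ⊆ P → P = ⊤

/-- `𝒰` is irreducible as a module over itself. -/
def SelfIrreducible (𝒰 : NLVA U) : Prop :=
  Nontrivial U ∧
    ∀ P : Submodule ℂ U, (∀ u : U, ∀ p ∈ P, ∀ n : ℤ, 𝒰.Y u p n ∈ P) → P = ⊥ ∨ P = ⊤

/-- The coefficients of the product `Y(v₁,x₁)⋯Y(v_n,x_n)𝟙`. -/
def prodY (𝒱 : NLVA V) : (n : ℕ) → (Fin n → V) → (Fin n → ℤ) → V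
  | 0, _, _ => 𝒱.one
  | n + 1, v, k => 𝒱.Y (v 0) (prodY 𝒱 n (fun i => v i.succ) fun i => k i.succ) (k 0)

/-- Non-degeneracy in the sense of Etingof–Kazhdan: the maps
`Z_n : V^{⊗n} ⊗ ℂ((x₁))⋯((x_n)) → V((x₁))⋯((x_n))` are injective. -/
def NonDegenerate (𝒱 : NLVA V) : Prop :=
  ∀ n : ℕ, 0 < n → ∀ (r : ℕ) (v : Fin r → Fin n → V) (f : Fin r → (Fin n → ℤ) → ℂ),
    (∀ j, IsIterLaurent n (f j)) →
    LinearIndependent ℂ (fun j : Fin r => PiTensorProduct.tprod ℂ (v j)) →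
    (∀ K' : Fin n → ℤ,
      (∑ j : Fin r, ∑ᶠ L : Fin n → ℤ,
        f j L • 𝒱.prodY n (v j) fun i => K' i - L i) = 0) →
    ∀ j, f j = 0

end NLVA

/-- Countable dimension over `ℂ`. -/
def CountableDim (U : Type*) [AddCommGroup U] [Module ℂ U] : Prop :=
  ∃ s : Set U, s.Countable ∧ Submodule.span ℂ s = ⊤

/-- `𝒱` satisfies `𝒮`-locality, i.e. is a weak quantum vertex algebra. -/
def SLocal {V : Type*} [AddCommGroup V] [Module ℂ V] (𝒱 : NLVA V) : Prop :=
  ∀ u v : V, ∃ (r : ℕ) (uu vv : Fin r → V) (f : Fin r → ℤ → ℂ) (k : ℕ),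
    (∀ i, IsLaurent (f i)) ∧ ∀ (w : V) (m n : ℤ),
      mulSubPow k (fun a b => 𝒱.Y u (𝒱.Y v w b) a) m n
        = mulSubPow k (fun a b => ∑ i, scalarMulSub (f i)
            (fun a' b' => 𝒱.Y (vv i) (𝒱.Y (uu i) w a') b') a b) m n

/-- A module for a nonlocal vertex algebra. -/
structure NLVAModule {V : Type*} [AddCommGroup V] [Module ℂ V] (𝒱 : NLVA V)
    (W : Type*) [AddCommGroup W] [Module ℂ W] where
  Yw : V →ₗ[ℂ] W →ₗ[ℂ] (ℤ → W)
  trunc : ∀ (v : V) (w : W), IsLaurent (Yw v w)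
  vacuum : ∀ (w : W) (n : ℤ), Yw 𝒱.one w n = if n = 0 then w else 0
  weak_assoc : ∀ (u v : V) (w : W), ∃ k : ℕ, ∀ a b : ℤ,
    mulAddPow k (substAdd02 fun m n => Yw u (Yw v w n) m) a b
      = mulAddPow k (fun a' b' => Yw (𝒱.Y u v a') w b') a b

section Twist

variable {U V : Type*} [AddCommGroup U] [Module ℂ U] [AddCommGroup V] [Module ℂ V]

/-- Coefficient of `x₁^m x₂^n` in `(Y(x₂)⊗1)R²³(x₁)R¹²(x₁+x₂)` applied to `v ⊗ u ⊗ u'`. -/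
def hex1RHS (𝒰 : NLVA U) (Rc : ℤ → (V ⊗[ℂ] U →ₗ[ℂ] U ⊗[ℂ] V))
    (v : V) (u u' : U) (m n : ℤ) : U ⊗[ℂ] V :=
  ∑ᶠ (i : ℕ) (c : ℤ),
    ((zchoose (m - c + i) i : ℤ) : ℂ) •
      (TensorProduct.map (TensorProduct.lift (𝒰.Yc (n - i))) LinearMap.id)
        ((TensorProduct.assoc ℂ U U V).symm
          ((LinearMap.lTensor U (Rc c))
            ((TensorProduct.assoc ℂ U V U)
              ((Rc (m - c + i) (v ⊗ₜ u)) ⊗ₜ u'))))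

/-- Coefficient of `x₁^m x₂^n` in `(1⊗Y(x₂))R¹²(x₁-x₂)R²³(x₁)` applied to `v ⊗ v' ⊗ u`. -/
def hex2RHS (𝒱 : NLVA V) (Rc : ℤ → (V ⊗[ℂ] U →ₗ[ℂ] U ⊗[ℂ] V))
    (v v' : V) (u : U) (m n : ℤ) : U ⊗[ℂ] V :=
  ∑ᶠ (i : ℕ) (c : ℤ),
    ((-1 : ℂ) ^ i * ((zchoose (m - c + i) i : ℤ) : ℂ)) •
      (LinearMap.lTensor U (TensorProduct.lift (𝒱.Yc (n - i))))
        ((TensorProduct.assoc ℂ U V V)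
          ((TensorProduct.map (Rc (m - c + i)) LinearMap.id)
            ((TensorProduct.assoc ℂ V U V).symm
              (v ⊗ₜ (Rc c (v' ⊗ₜ u))))))

/-- A twisting operator `R(x) : V ⊗ U → U ⊗ V ⊗ ℂ((x))` for the ordered pair `(U,V)`,
given by its family of coefficients `Rc n`. -/
structure TwistingOp (𝒰 : NLVA U) (𝒱 : NLVA V) where
  Rc : ℤ → (V ⊗[ℂ] U →ₗ[ℂ] U ⊗[ℂ] V)
  laurent : ∀ t : V ⊗[ℂ] U, IsTensorLaurent fun n => Rc n t
  vac_right : ∀ (v : V) (n : ℤ),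
    Rc n (v ⊗ₜ 𝒰.one) = if n = 0 then 𝒰.one ⊗ₜ v else 0
  vac_left : ∀ (u : U) (n : ℤ),
    Rc n (𝒱.one ⊗ₜ u) = if n = 0 then u ⊗ₜ 𝒱.one else 0
  hex1 : ∀ (v : V) (u u' : U) (m n : ℤ),
    Rc m (v ⊗ₜ (𝒰.Y u u' n)) = hex1RHS 𝒰 Rc v u u' m n
  hex2 : ∀ (v v' : V) (u : U) (m n : ℤ),
    Rc m ((𝒱.Y v v' n) ⊗ₜ u) = hex2RHS 𝒱 Rc v v' u m n

/-- `Sc` is a two-sided inverse of `Rc` as `ℂ((x))`-linear maps (coefficientwise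
convolution), with values in the tensor with `ℂ((x))`. -/
def IsInvPair {A B : Type*} [AddCommGroup A] [Module ℂ A] [AddCommGroup B] [Module ℂ B]
    (Rc : ℤ → (A →ₗ[ℂ] B)) (Sc : ℤ → (B →ₗ[ℂ] A)) : Prop :=
  (∀ t : B, IsTensorLaurent fun n => Sc n t) ∧
  (∀ (t : A) (n : ℤ), (∑ᶠ c : ℤ, Sc c (Rc (n - c) t)) = if n = 0 then t else 0) ∧
  (∀ (t : B) (n : ℤ), (∑ᶠ c : ℤ, Rc c (Sc (n - c) t)) = if n = 0 then t else 0)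

/-- The canonical embedding `u ↦ u ⊗ 𝟙`. -/
def iotaU (𝒱 : NLVA V) : U →ₗ[ℂ] U ⊗[ℂ] V := (TensorProduct.mk ℂ U V).flip 𝒱.one

/-- The canonical embedding `v ↦ 𝟙 ⊗ v`. -/
def iotaV (𝒰 : NLVA U) : V →ₗ[ℂ] U ⊗[ℂ] V := TensorProduct.mk ℂ U V 𝒰.one

/-- The operator `D ⊗ 1 + 1 ⊗ D` on `U ⊗ V`. -/
def DUV (𝒰 : NLVA U) (𝒱 : NLVA V) : U ⊗[ℂ] V →ₗ[ℂ] U ⊗[ℂ] V :=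
  LinearMap.rTensor V 𝒰.D + LinearMap.lTensor U 𝒱.D

/-- The coefficient of `x^n` in `Y_R(u⊗v, x)(u'⊗v') = (Y(x)⊗Y(x))R²³(-x)(u⊗v⊗u'⊗v')`. -/
def YRcoef (𝒰 : NLVA U) (𝒱 : NLVA V) (Rop : TwistingOp 𝒰 𝒱)
    (u : U) (v : V) (u' : U) (v' : V) (n : ℤ) : U ⊗[ℂ] V :=
  ∑ᶠ (c : ℤ) (a : ℤ),
    ((-1 : ℂ) ^ c) •
      (TensorProduct.map (𝒰.Yc a u) ((𝒱.Yc (n - c - a)).flip v'))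
        (Rop.Rc c (v ⊗ₜ u'))

/-- `𝒯` is the twisted tensor product nonlocal vertex algebra `U ⊗_R V`. -/
def IsTwistedTensor (𝒰 : NLVA U) (𝒱 : NLVA V) (Rop : TwistingOp 𝒰 𝒱)
    (𝒯 : NLVA (U ⊗[ℂ] V)) : Prop :=
  𝒯.one = 𝒰.one ⊗ₜ 𝒱.one ∧
  ∀ (u u' : U) (v v' : V) (n : ℤ),
    𝒯.Y (u ⊗ₜ v) (u' ⊗ₜ v') n = YRcoef 𝒰 𝒱 Rop u v u' v' n

end Twist

section Aux

variable {A B W T : Type*} [AddCommGroup A] [Module ℂ A] [AddCommGroup B] [Module ℂ B]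
  [AddCommGroup W] [Module ℂ W] [AddCommGroup T] [Module ℂ T]

/-- The linear map `(a ⊗ b) ↦ Y_A(a)_e (Y_B(b)_j w)`, i.e. the coefficient
of `Y_A(x₂)(1 ⊗ Y_B(x₁)) (· ⊗ · ⊗ w)` at `x₂^e x₁^j`. -/
def sandwichMod (YA : A →ₗ[ℂ] W →ₗ[ℂ] (ℤ → W)) (YB : B →ₗ[ℂ] W →ₗ[ℂ] (ℤ → W))
    (w : W) (e j : ℤ) : A ⊗[ℂ] B →ₗ[ℂ] W :=
  TensorProduct.lift
    ((YA.compr₂ (LinearMap.proj e)).compl₂ ((YB.compr₂ (LinearMap.proj j)).flip w))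

/-- Coefficient of `x₁^m x₂^n` in `Y_A(x₂)(1 ⊗ Y_B(x₁)) q(x₂ - x₁) (⋯ ⊗ w)`, where the
series `q` is evaluated at `x₂ - x₁`, expanded in nonnegative powers of `x₁`. -/
def twistRHS (YA : A →ₗ[ℂ] W →ₗ[ℂ] (ℤ → W)) (YB : B →ₗ[ℂ] W →ₗ[ℂ] (ℤ → W))
    (q : ℤ → A ⊗[ℂ] B) (w : W) : ℤ → ℤ → W := fun m n =>
  ∑ᶠ (i : ℕ) (p : ℤ),
    ((-1 : ℂ) ^ i * ((zchoose p i : ℤ) : ℂ)) •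
      sandwichMod YA YB w (n - p + i) (m - i) (q p)

/-- As `twistRHS`, but with `q` evaluated at `-x₂ + x₁`, expanded in nonnegative
powers of `x₂`. -/
def twistRHSalt (YA : A →ₗ[ℂ] W →ₗ[ℂ] (ℤ → W)) (YB : B →ₗ[ℂ] W →ₗ[ℂ] (ℤ → W))
    (q : ℤ → A ⊗[ℂ] B) (w : W) : ℤ → ℤ → W := fun m n =>
  ∑ᶠ (i : ℕ) (p : ℤ),
    ((-1 : ℂ) ^ i * ((zchoose p i : ℤ) : ℂ)) •
      sandwichMod YA YB w (n - i) (m - p + i) (q p)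

/-- Coefficient of `x^n` in `e^{xD} F(x)` where `F` is given by its coefficients. -/
def expD (Dop : T →ₗ[ℂ] T) (F : ℤ → T) (n : ℤ) : T :=
  ∑ᶠ j : ℕ, ((j.factorial : ℂ))⁻¹ • (Dop ^ j) (F (n - j))

end Aux

section YBE

variable {V : Type*} [AddCommGroup V] [Module ℂ V]

/-- The flip of the last two tensor factors of `(V⊗V)⊗V`. -/
def swap23 : (V ⊗[ℂ] V) ⊗[ℂ] V →ₗ[ℂ] (V ⊗[ℂ] V) ⊗[ℂ] V :=
  ((TensorProduct.assoc ℂ V V V).symm.toLinearMap).comp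
    ((LinearMap.lTensor V (TensorProduct.comm ℂ V V).toLinearMap).comp
      (TensorProduct.assoc ℂ V V V).toLinearMap)

/-- `S¹²` acting on `(V⊗V)⊗V`. -/
def S12m (Sc : ℤ → (V ⊗[ℂ] V →ₗ[ℂ] V ⊗[ℂ] V)) (c : ℤ) :
    (V ⊗[ℂ] V) ⊗[ℂ] V →ₗ[ℂ] (V ⊗[ℂ] V) ⊗[ℂ] V :=
  TensorProduct.map (Sc c) LinearMap.id

/-- `S²³` acting on `(V⊗V)⊗V`. -/
def S23m (Sc : ℤ → (V ⊗[ℂ] V →ₗ[ℂ] V ⊗[ℂ] V)) (c : ℤ) :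
    (V ⊗[ℂ] V) ⊗[ℂ] V →ₗ[ℂ] (V ⊗[ℂ] V) ⊗[ℂ] V :=
  ((TensorProduct.assoc ℂ V V V).symm.toLinearMap).comp
    ((LinearMap.lTensor V (Sc c)).comp (TensorProduct.assoc ℂ V V V).toLinearMap)

/-- `S¹³` acting on `(V⊗V)⊗V`. -/
def S13m (Sc : ℤ → (V ⊗[ℂ] V →ₗ[ℂ] V ⊗[ℂ] V)) (c : ℤ) :
    (V ⊗[ℂ] V) ⊗[ℂ] V →ₗ[ℂ] (V ⊗[ℂ] V) ⊗[ℂ] V :=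
  swap23.comp ((S12m Sc c).comp swap23)

/-- `S²¹(x) = σ S(x) σ`. -/
def S21c (Sc : ℤ → (V ⊗[ℂ] V →ₗ[ℂ] V ⊗[ℂ] V)) (c : ℤ) :
    V ⊗[ℂ] V →ₗ[ℂ] V ⊗[ℂ] V :=
  ((TensorProduct.comm ℂ V V).toLinearMap).comp
    ((Sc c).comp (TensorProduct.comm ℂ V V).toLinearMap)

/-- The quantum Yang–Baxter equation
`S¹²(x)S¹³(x+z)S²³(z) = S²³(z)S¹³(x+z)S¹²(x)` (coefficient of `x^a z^b`, with
`S¹³(x+z)` expanded in nonnegative powers of `z`). -/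
def QYBE (Sc : ℤ → (V ⊗[ℂ] V →ₗ[ℂ] V ⊗[ℂ] V)) : Prop :=
  ∀ (t : (V ⊗[ℂ] V) ⊗[ℂ] V) (a b : ℤ),
    (∑ᶠ (i : ℕ) (p : ℤ), ((zchoose p i : ℤ) : ℂ) •
        S12m Sc (a - p + i) (S13m Sc p (S23m Sc (b - i) t)))
      = ∑ᶠ (i : ℕ) (p : ℤ), ((zchoose p i : ℤ) : ℂ) •
          S23m Sc (b - i) (S13m Sc p (S12m Sc (a - p + i) t))

/-- Unitarity: `S(x) S²¹(-x) = 1`. -/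
def Unitary (Sc : ℤ → (V ⊗[ℂ] V →ₗ[ℂ] V ⊗[ℂ] V)) : Prop :=
  ∀ (t : V ⊗[ℂ] V) (n : ℤ),
    (∑ᶠ c : ℤ, ((-1 : ℂ) ^ (n - c)) • Sc c (S21c Sc (n - c) t))
      = if n = 0 then t else 0

/-- `[D ⊗ 1, S(x)] = -(d/dx) S(x)`. -/
def DComm1 (𝒱 : NLVA V) (Sc : ℤ → (V ⊗[ℂ] V →ₗ[ℂ] V ⊗[ℂ] V)) : Prop :=
  ∀ (t : V ⊗[ℂ] V) (n : ℤ),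
    (LinearMap.rTensor V 𝒱.D) (Sc n t) - Sc n ((LinearMap.rTensor V 𝒱.D) t)
      = (-((n : ℂ) + 1)) • Sc (n + 1) t

/-- `Y(u,x)v = e^{xD} Y(-x) S(-x)(v⊗u)`. -/
def SkewS (𝒱 : NLVA V) (Sc : ℤ → (V ⊗[ℂ] V →ₗ[ℂ] V ⊗[ℂ] V)) : Prop :=
  ∀ (u v : V) (n : ℤ),
    𝒱.Y u v n = expD 𝒱.D (fun p => ((-1 : ℂ) ^ p) •
      ∑ᶠ c : ℤ, (TensorProduct.lift (𝒱.Yc (p - c))) (Sc c (v ⊗ₜ u))) n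

/-- `S(x₁)(Y(x₂)⊗1) = (Y(x₂)⊗1)S²³(x₁)S¹³(x₁+x₂)`. -/
def HexY1 (𝒱 : NLVA V) (Sc : ℤ → (V ⊗[ℂ] V →ₗ[ℂ] V ⊗[ℂ] V)) : Prop :=
  ∀ (t : (V ⊗[ℂ] V) ⊗[ℂ] V) (m n : ℤ),
    Sc m ((TensorProduct.map (TensorProduct.lift (𝒱.Yc n)) LinearMap.id) t)
      = ∑ᶠ (i : ℕ) (p : ℤ), ((zchoose p i : ℤ) : ℂ) •
          (TensorProduct.map (TensorProduct.lift (𝒱.Yc (n - i))) LinearMap.id)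
            (S23m Sc (m - p + i) (S13m Sc p t))

/-- `S(x₁)(1⊗Y(x₂)) = (1⊗Y(x₂))S¹²(x₁-x₂)S¹³(x₁)`. -/
def HexY2 (𝒱 : NLVA V) (Sc : ℤ → (V ⊗[ℂ] V →ₗ[ℂ] V ⊗[ℂ] V)) : Prop :=
  ∀ (t : (V ⊗[ℂ] V) ⊗[ℂ] V) (m n : ℤ),
    Sc m ((LinearMap.lTensor V (TensorProduct.lift (𝒱.Yc n)))
        ((TensorProduct.assoc ℂ V V V) t))
      = ∑ᶠ (i : ℕ) (p : ℤ), ((-1 : ℂ) ^ i * ((zchoose p i : ℤ) : ℂ)) •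
          (LinearMap.lTensor V (TensorProduct.lift (𝒱.Yc (n - i))))
            ((TensorProduct.assoc ℂ V V V)
              (S12m Sc p (S13m Sc (m - p + i) t)))

/-- A quantum vertex algebra `(V, 𝒮)`. -/
structure QVA (V : Type*) [AddCommGroup V] [Module ℂ V] where
  alg : NLVA V
  sloc : SLocal alg
  Sc : ℤ → (V ⊗[ℂ] V →ₗ[ℂ] V ⊗[ℂ] V)
  laurent : ∀ t : V ⊗[ℂ] V, IsTensorLaurent fun n => Sc n t
  qybe : QYBE Sc
  unitary : Unitary Sc
  vac : ∀ (v : V) (n : ℤ), Sc n (alg.one ⊗ₜ v) = if n = 0 then alg.one ⊗ₜ v else 0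
  dcomm : DComm1 alg Sc
  skew : SkewS alg Sc
  hex : HexY1 alg Sc

end YBE

section Bialg

variable {H : Type*} [AddCommGroup H] [Module ℂ H]

/-- A nonlocal vertex bialgebra. -/
structure NLVBialg (H : Type*) [AddCommGroup H] [Module ℂ H] where
  alg : NLVA H
  comul : H →ₗ[ℂ] H ⊗[ℂ] H
  counit : H →ₗ[ℂ] ℂ
  coassoc : ∀ h : H, (LinearMap.lTensor H comul) (comul h)
      = (TensorProduct.assoc ℂ H H H) ((LinearMap.rTensor H comul) (comul h))
  counit_comul_left : ∀ h : H,
      (TensorProduct.lid ℂ H) ((LinearMap.rTensor H counit) (comul h)) = h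
  counit_comul_right : ∀ h : H,
      (TensorProduct.rid ℂ H) ((LinearMap.lTensor H counit) (comul h)) = h
  counit_one : counit alg.one = 1
  counit_mul : ∀ (a b : H) (n : ℤ),
      counit (alg.Y a b n) = if n = 0 then counit a * counit b else 0
  comul_one : comul alg.one = alg.one ⊗ₜ alg.one
  comul_mul : ∀ (a b : H) (n : ℤ),
      comul (alg.Y a b n)
        = ∑ᶠ p : ℤ, (TensorProduct.map₂ (alg.Yc p) (alg.Yc (n - p))) (comul a) (comul b)

/-- A nonlocal vertex `H`-module-algebra. -/
structure NLVModAlg (𝓗 : NLVBialg H) (U : Type*) [AddCommGroup U] [Module ℂ U] where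
  alg : NLVA U
  act : NLVAModule 𝓗.alg U
  scalar : ∀ (h : H) (u : U), IsTensorLaurent fun n => act.Yw h u n
  vac : ∀ (h : H) (n : ℤ),
      act.Yw h alg.one n = if n = 0 then 𝓗.counit h • alg.one else 0
  compat : ∀ (h : H) (u v : U) (m n : ℤ),
      act.Yw h (alg.Y u v n) m
        = ∑ᶠ (i : ℕ) (p : ℤ), ((-1 : ℂ) ^ i * ((zchoose p i : ℤ) : ℂ)) •
            (TensorProduct.lift
              (((alg.Yc (n - i)).comp ((act.Yw.compr₂ (LinearMap.proj p)).flip u)).compl₂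
                ((act.Yw.compr₂ (LinearMap.proj (m - p + i))).flip v)))
            (𝓗.comul h)

/-- A nonlocal vertex `H`-comodule-algebra. -/
structure NLVComodAlg (𝓗 : NLVBialg H) (V : Type*) [AddCommGroup V] [Module ℂ V] where
  alg : NLVA V
  rho : V →ₗ[ℂ] H ⊗[ℂ] V
  coassoc : ∀ v : V, (LinearMap.lTensor H rho) (rho v)
      = (TensorProduct.assoc ℂ H H V) ((LinearMap.rTensor V 𝓗.comul) (rho v))
  counit_rho : ∀ v : V,
      (TensorProduct.lid ℂ V) ((LinearMap.rTensor V 𝓗.counit) (rho v)) = v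
  rho_one : rho alg.one = 𝓗.alg.one ⊗ₜ alg.one
  rho_mul : ∀ (v v' : V) (n : ℤ),
      rho (alg.Y v v' n)
        = ∑ᶠ p : ℤ, (TensorProduct.map₂ (𝓗.alg.Yc p) (alg.Yc (n - p))) (rho v) (rho v')

/-- The coefficient of `x^n` in
`Y_♯(u⊗v, x)(u'⊗v') = Y(u,x)Y(b¹(v),x)u' ⊗ Y(v²,x)v'`. -/
def Ysharp (𝓗 : NLVBialg H) {U V : Type*} [AddCommGroup U] [Module ℂ U]
    [AddCommGroup V] [Module ℂ V] (MU : NLVModAlg 𝓗 U) (CV : NLVComodAlg 𝓗 V)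
    (u : U) (v : V) (u' : U) (v' : V) (n : ℤ) : U ⊗[ℂ] V :=
  ∑ᶠ (a : ℤ) (p : ℤ),
    (TensorProduct.map
      ((MU.alg.Yc a u).comp ((MU.act.Yw.compr₂ (LinearMap.proj p)).flip u'))
      ((CV.alg.Yc (n - a - p)).flip v'))
    (CV.rho v)

/-- Rearrangement `(H⊗V)⊗U → (H⊗U)⊗V`. -/
def smashSwap {U V : Type*} [AddCommGroup U] [Module ℂ U]
    [AddCommGroup V] [Module ℂ V] :
    (H ⊗[ℂ] V) ⊗[ℂ] U →ₗ[ℂ] (H ⊗[ℂ] U) ⊗[ℂ] V :=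
  ((TensorProduct.assoc ℂ H U V).symm.toLinearMap).comp
    ((LinearMap.lTensor H (TensorProduct.comm ℂ V U).toLinearMap).comp
      (TensorProduct.assoc ℂ H V U).toLinearMap)

/-- The coefficient of `x^n` in `R(x)(v⊗u) = Y(b¹(v),-x)u ⊗ v²`. -/
def Rsmash (𝓗 : NLVBialg H) {U V : Type*} [AddCommGroup U] [Module ℂ U]
    [AddCommGroup V] [Module ℂ V] (MU : NLVModAlg 𝓗 U) (CV : NLVComodAlg 𝓗 V)
    (n : ℤ) : V ⊗[ℂ] U →ₗ[ℂ] U ⊗[ℂ] V :=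
  ((-1 : ℂ) ^ n) •
    ((TensorProduct.map
        (TensorProduct.lift (MU.act.Yw.compr₂ (LinearMap.proj n))) LinearMap.id).comp
      (smashSwap.comp (LinearMap.rTensor U CV.rho)))

end Bialg

section FiniteSupport

variable {α β M : Type*} [AddCommGroup M]

lemma hasFiniteSupport_of_forall_mem {f : α → M} (s : Set α) (hs : s.Finite)
    (h : ∀ x, f x ≠ 0 → x ∈ s) : f.HasFiniteSupport :=
  hs.subset fun x hx => h x hx

lemma hasFiniteSupport_int {f : ℤ → M} (a b : ℤ) (h : ∀ x, x < a ∨ b < x → f x = 0) :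
    f.HasFiniteSupport :=
  hasFiniteSupport_of_forall_mem (Set.Icc a b) (Set.finite_Icc a b) fun x hx => by
    by_contra hc
    refine hx (h x ?_)
    simp only [Set.mem_Icc] at hc
    omega

lemma finsum_finsum_comm (f : α → β → M) (s : Set α) (t : Set β) (hs : s.Finite) (ht : t.Finite)
    (h : ∀ a b, f a b ≠ 0 → a ∈ s ∧ b ∈ t) :
    ∑ᶠ a, ∑ᶠ b, f a b = ∑ᶠ b, ∑ᶠ a, f a b := by
  rw [← finsum_curry (fun x : α × β => f x.1 x.2)
      (hasFiniteSupport_of_forall_mem (s ×ˢ t) (hs.prod ht) fun x hx => h _ _ hx),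
    ← finsum_curry (fun x : β × α => f x.2 x.1)
      (hasFiniteSupport_of_forall_mem (t ×ˢ s) (ht.prod hs) fun x hx => (h _ _ hx).symm)]
  exact (finsum_comp_equiv (Equiv.prodComm β α) (f := fun x : α × β => f x.1 x.2)).symm

lemma finsum_finsum_nat_eq_sum_antidiagonal (f : ℕ → ℕ → M) (L : ℕ)
    (h : ∀ i j, L ≤ i + j → f i j = 0) :
    ∑ᶠ i, ∑ᶠ j, f i j
      = ∑ k ∈ Finset.range L, ∑ ij ∈ Finset.HasAntidiagonal.antidiagonal k, f ij.1 ij.2 := by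
  have h1 : ∀ i, ∑ᶠ j, f i j = ∑ j ∈ Finset.range (L - i), f i j := fun i =>
    finsum_eq_finsetSum_of_support_subset _ fun j hj => by
      by_contra hc
      exact hj (h i j (by simp at hc; omega))
  have h2 : ∑ᶠ i, ∑ᶠ j, f i j = ∑ i ∈ Finset.range L, ∑ᶠ j, f i j :=
    finsum_eq_finsetSum_of_support_subset _ fun i hi => by
      by_contra hc
      refine hi ?_
      simp only [Finset.coe_range, Set.mem_Iio, not_lt] at hc
      simp only [h1, Nat.sub_eq_zero_of_le hc, Finset.sum_range_zero]
  rw [h2]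
  simp_rw [h1, Finset.Nat.sum_antidiagonal_eq_sum_range_succ f]
  exact (Finset.sum_range_diag_flip L f).symm

end FiniteSupport

lemma zchoose_eq_choose (n : ℤ) (k : ℕ) : zchoose n k = Ring.choose n k := by
  unfold zchoose
  split_ifs with h
  · lift n to ℕ using h
    simp [Ring.choose_natCast]
  · obtain ⟨r, rfl⟩ : ∃ r : ℕ, n = -((r : ℤ) + 1) := ⟨(-n - 1).toNat, by omega⟩
    have e : ((k : ℤ) - -((r : ℤ) + 1) - 1) = ((r + k : ℕ) : ℤ) := by push_cast; ring
    rw [Ring.choose_neg, e, show ((r : ℤ) + 1 + k - 1) = ((r + k : ℕ) : ℤ) by push_cast; ring,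
      Ring.choose_natCast, Int.toNat_natCast, Int.negOnePow_def]
    simp [Units.smul_def]

lemma sum_antidiagonal_zchoose_mul (p q : ℤ) (k : ℕ) :
    ∑ ij ∈ Finset.HasAntidiagonal.antidiagonal k, zchoose p ij.2 * zchoose q ij.1 = zchoose (p + q) k := by
  simp_rw [zchoose_eq_choose]
  rw [add_comm p q, Ring.add_choose_eq k (Commute.all q p)]
  exact Finset.sum_congr rfl fun _ _ => mul_comm _ _

lemma zchoose_zero_left (k : ℕ) : zchoose 0 k = if k = 0 then 1 else 0 := by
  rcases k with _ | k <;> simp [zchoose]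

section OperatorFamilies

variable {A B C : Type*} [AddCommGroup A] [Module ℂ A] [AddCommGroup B] [Module ℂ B]
  [AddCommGroup C] [Module ℂ C]

/-- `P` is the coefficient family of a map `A → B ⊗ ℂ((x))`. -/
def IsLaurentFamily (P : ℤ → (A →ₗ[ℂ] B)) : Prop :=
  ∀ t : A, IsTensorLaurent fun n => P n t

lemma IsLaurentFamily.exists_bound {P : ℤ → (A →ₗ[ℂ] B)} (hP : IsLaurentFamily P)
    {F : Submodule ℂ A} (hF : F.FG) :
    ∃ F' : Submodule ℂ B, F'.FG ∧ ∃ N : ℤ, ∀ t ∈ F, ∀ n, P n t ∈ F' ∧ (n < N → P n t = 0) := by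
  induction F, hF using Submodule.fg_induction with
  | singleton x =>
    obtain ⟨⟨N, hN⟩, F', hF', h⟩ := hP x
    refine ⟨F', hF', N, fun t ht n => ?_⟩
    obtain ⟨c, rfl⟩ := Submodule.mem_span_singleton.1 ht
    rw [map_smul]
    exact ⟨F'.smul_mem c (h n), fun hn => by rw [show P n x = 0 from hN n hn, smul_zero]⟩
  | sup F₁ F₂ _ _ h₁ h₂ =>
    obtain ⟨F₁', hF₁', N₁, h₁⟩ := h₁
    obtain ⟨F₂', hF₂', N₂, h₂⟩ := h₂
    refine ⟨F₁' ⊔ F₂', hF₁'.sup hF₂', min N₁ N₂, fun t ht n => ?_⟩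
    obtain ⟨a, ha, b, hb, rfl⟩ := Submodule.mem_sup.1 ht
    rw [map_add]
    refine ⟨Submodule.add_mem_sup (h₁ a ha n).1 (h₂ b hb n).1, fun hn => ?_⟩
    rw [(h₁ a ha n).2 (by omega), (h₂ b hb n).2 (by omega), add_zero]

/-- `P(x) Q(x) = 1`, coefficientwise. -/
def IsLeftInverseFamily (P : ℤ → (B →ₗ[ℂ] A)) (Q : ℤ → (A →ₗ[ℂ] B)) : Prop :=
  ∀ (t : A) (n : ℤ), ∑ᶠ c : ℤ, P (n - c) (Q c t) = if n = 0 then t else 0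

lemma hasFiniteSupport_conv {P : ℤ → (B →ₗ[ℂ] A)} (hP : IsLaurentFamily P) {u : ℤ → B}
    (hu : IsTensorLaurent u) (n : ℤ) :
    (fun c => P (n - c) (u c)).HasFiniteSupport := by
  obtain ⟨⟨N, hN⟩, F, hF, h⟩ := hu
  obtain ⟨F', -, N', h'⟩ := hP.exists_bound hF
  refine hasFiniteSupport_int N (n - N') fun c hc => ?_
  rcases hc with hc | hc
  · rw [hN c hc, map_zero]
  · exact (h' _ (h c) _).2 (by omega)

/-- Left multiplication by `P(x)` can be undone by a left inverse of `P(x)`. -/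
lemma IsLeftInverseFamily.conv_conv {P : ℤ → (B →ₗ[ℂ] A)} {Q : ℤ → (A →ₗ[ℂ] B)}
    (h : IsLeftInverseFamily P Q) (hP : IsLaurentFamily P) (hQ : IsLaurentFamily Q)
    {u : ℤ → A} (hu : IsTensorLaurent u) (m : ℤ) :
    ∑ᶠ a : ℤ, P (m - a) (∑ᶠ e : ℤ, Q (a - e) (u e)) = u m := by
  obtain ⟨⟨N, hN⟩, F, hF, huF⟩ := id hu
  obtain ⟨F', hF', N', h'⟩ := hQ.exists_bound hF
  obtain ⟨F'', -, N'', h''⟩ := hP.exists_bound hF'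
  simp_rw [fun a => map_finsum (P (m - a)) (hasFiniteSupport_conv hQ hu a)]
  rw [finsum_finsum_comm _ (Set.Icc (N + N') (m - N'')) (Set.Icc N (m - N' - N''))
    (Set.finite_Icc _ _) (Set.finite_Icc _ _)]
  · have key : ∀ e, ∑ᶠ a : ℤ, P (m - a) (Q (a - e) (u e)) = if m - e = 0 then u e else 0 := by
      intro e
      rw [← h (u e) (m - e), ← finsum_comp_equiv (Equiv.addRight e)]
      exact finsum_congr fun c => by simp [sub_sub, add_comm]
    simp_rw [key]
    rw [finsum_eq_single _ m fun e he => if_neg (by omega)]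
    simp
  · intro a e hae
    have h1 : N ≤ e := by
      by_contra hc
      exact hae (by rw [hN e (by omega), map_zero, map_zero])
    have h2 : N' ≤ a - e := by
      by_contra hc
      exact hae (by rw [(h' _ (huF e) _).2 (by omega), map_zero])
    have h3 : N'' ≤ m - a := by
      by_contra hc
      exact hae ((h'' _ (h' _ (huF e) _).1 _).2 (by omega))
    simp only [Set.mem_Icc]
    omega

lemma IsLaurentFamily.conj {P : ℤ → (B →ₗ[ℂ] B)} (hP : IsLaurentFamily P) (e : A →ₗ[ℂ] B)
    (e' : B →ₗ[ℂ] A) : IsLaurentFamily fun c => e' ∘ₗ P c ∘ₗ e := by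
  intro t
  obtain ⟨⟨N, hN⟩, F, hF, h⟩ := hP (e t)
  exact ⟨⟨N, fun n hn => (congrArg e' (hN n hn)).trans (map_zero e')⟩, F.map e', hF.map e',
    fun n => Submodule.mem_map_of_mem (h n)⟩

lemma IsLeftInverseFamily.conj {P Q : ℤ → (B →ₗ[ℂ] B)} (h : IsLeftInverseFamily P Q)
    (hP : IsLaurentFamily P) (hQ : IsLaurentFamily Q) {e : A →ₗ[ℂ] B} {e' : B →ₗ[ℂ] A}
    (he : e' ∘ₗ e = LinearMap.id) (he' : e ∘ₗ e' = LinearMap.id) :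
    IsLeftInverseFamily (fun c => e' ∘ₗ P c ∘ₗ e) (fun c => e' ∘ₗ Q c ∘ₗ e) := by
  intro t n
  have he't : ∀ b, e (e' b) = b := fun b => LinearMap.congr_fun he' b
  simp only [LinearMap.comp_apply, he't]
  rw [← map_finsum e' (hasFiniteSupport_conv hP (hQ (e t)) n), h]
  split_ifs
  · exact LinearMap.congr_fun he t
  · exact map_zero e'

lemma IsLaurentFamily.rTensor {P : ℤ → (A →ₗ[ℂ] B)} (hP : IsLaurentFamily P) :
    IsLaurentFamily fun c => TensorProduct.map (P c) (LinearMap.id : C →ₗ[ℂ] C) := by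
  intro t
  induction t using TensorProduct.induction_on with
  | zero => exact ⟨⟨0, fun n _ => map_zero _⟩, ⊥, Submodule.fg_bot, fun n => by simp⟩
  | tmul x v =>
    obtain ⟨⟨N, hN⟩, F, hF, h⟩ := hP x
    refine ⟨⟨N, fun n hn => ?_⟩, F.map ((TensorProduct.mk ℂ B C).flip v), hF.map _, fun n => ?_⟩
    · simp [show P n x = 0 from hN n hn]
    · exact Submodule.mem_map_of_mem (h n)
  | add x y hx hy =>
    obtain ⟨⟨N₁, hN₁⟩, F₁, hF₁, h₁⟩ := hx
    obtain ⟨⟨N₂, hN₂⟩, F₂, hF₂, h₂⟩ := hy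
    simp only [map_add]
    refine ⟨⟨min N₁ N₂, fun n hn => ?_⟩, F₁ ⊔ F₂, hF₁.sup hF₂, fun n =>
      Submodule.add_mem_sup (h₁ n) (h₂ n)⟩
    exact (congrArg₂ _ (hN₁ n (by omega)) (hN₂ n (by omega))).trans (add_zero _)

lemma IsLeftInverseFamily.rTensor {P : ℤ → (B →ₗ[ℂ] A)} {Q : ℤ → (A →ₗ[ℂ] B)}
    (h : IsLeftInverseFamily P Q) (hP : IsLaurentFamily P) (hQ : IsLaurentFamily Q) :
    IsLeftInverseFamily (fun c => TensorProduct.map (P c) (LinearMap.id : C →ₗ[ℂ] C))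
      (fun c => TensorProduct.map (Q c) (LinearMap.id : C →ₗ[ℂ] C)) := by
  intro t n
  induction t using TensorProduct.induction_on with
  | zero => simp
  | tmul x v =>
    simp only [TensorProduct.map_tmul, LinearMap.id_apply]
    have := map_finsum ((TensorProduct.mk ℂ A C).flip v) (hasFiniteSupport_conv hP (hQ x) n)
    simp only [LinearMap.flip_apply, TensorProduct.mk_apply] at this
    rw [← this, h]
    split_ifs <;> simp
  | add x y hx hy =>
    simp only [map_add]
    rw [finsum_add_distrib (hasFiniteSupport_conv hP.rTensor (hQ.rTensor x) n)
      (hasFiniteSupport_conv hP.rTensor (hQ.rTensor y) n), hx, hy]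
    split_ifs <;> simp

/-- `W` is the coefficient family of a map `A → B ⊗ ℂ((z, x))`. -/
def IsLaurentFamily₂ (W : ℤ → ℤ → (A →ₗ[ℂ] B)) : Prop :=
  ∀ F : Submodule ℂ A, F.FG → ∃ F' : Submodule ℂ B, F'.FG ∧ ∃ N : ℤ,
    ∀ t ∈ F, ∀ p c, W p c t ∈ F' ∧ (p < N ∨ c < N → W p c t = 0)

lemma IsLaurentFamily.comp {P : ℤ → (B →ₗ[ℂ] C)} {Q : ℤ → (A →ₗ[ℂ] B)}
    (hP : IsLaurentFamily P) (hQ : IsLaurentFamily Q) :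
    IsLaurentFamily₂ fun p c => P c ∘ₗ Q p := by
  intro F hF
  obtain ⟨F', hF', N', h'⟩ := hQ.exists_bound hF
  obtain ⟨F'', hF'', N'', h''⟩ := hP.exists_bound hF'
  refine ⟨F'', hF'', min N' N'', fun t ht p c => ⟨(h'' _ (h' t ht p).1 c).1, fun hpc => ?_⟩⟩
  rcases hpc with hpc | hpc
  · simp [(h' t ht p).2 (by omega)]
  · exact (h'' _ (h' t ht p).1 c).2 (by omega)

lemma IsLaurentFamily₂.swap {W : ℤ → ℤ → (A →ₗ[ℂ] B)} (hW : IsLaurentFamily₂ W) :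
    IsLaurentFamily₂ fun p c => W c p := by
  intro F hF
  obtain ⟨F', hF', N, h⟩ := hW F hF
  exact ⟨F', hF', N, fun t ht p c => ⟨(h t ht c p).1, fun hpc => (h t ht c p).2 hpc.symm⟩⟩

/-- `W(z, x) W'(z, x) = 1`, coefficientwise. -/
def IsLeftInverseFamily₂ (W : ℤ → ℤ → (B →ₗ[ℂ] A)) (W' : ℤ → ℤ → (A →ₗ[ℂ] B)) : Prop :=
  ∀ (t : A) (r d : ℤ), ∑ᶠ (p : ℤ) (c : ℤ), W (r - p) (d - c) (W' p c t)
    = if r = 0 ∧ d = 0 then t else 0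

lemma IsLeftInverseFamily.comp {P P' Q Q' : ℤ → (A →ₗ[ℂ] A)}
    (hP : IsLeftInverseFamily P P') (hQ : IsLeftInverseFamily Q Q')
    (lP : IsLaurentFamily P) (lP' : IsLaurentFamily P') (lQ : IsLaurentFamily Q)
    (lQ' : IsLaurentFamily Q') :
    IsLeftInverseFamily₂ (fun p c => P c ∘ₗ Q p) (fun p c => Q' p ∘ₗ P' c) := by
  intro t r d
  obtain ⟨⟨N₁, h₁⟩, F₁, hF₁, m₁⟩ := lP' t
  obtain ⟨F₂, hF₂, N₂, h₂⟩ := lQ'.exists_bound hF₁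
  obtain ⟨F₃, hF₃, N₃, h₃⟩ := lQ.exists_bound hF₂
  obtain ⟨F₄, hF₄, N₄, h₄⟩ := lP.exists_bound hF₃
  rw [finsum_finsum_comm _ (Set.Icc N₂ (r - N₃)) (Set.Icc N₁ (d - N₄)) (Set.finite_Icc _ _)
    (Set.finite_Icc _ _)]
  · have key : ∀ c, ∑ᶠ p : ℤ, (P (d - c) ∘ₗ Q (r - p)) ((Q' p ∘ₗ P' c) t)
        = if r = 0 then P (d - c) (P' c t) else 0 := by
      intro c
      simp only [LinearMap.comp_apply]
      rw [← map_finsum (P (d - c)) (hasFiniteSupport_conv lQ (lQ' (P' c t)) r), hQ]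
      split_ifs <;> simp
    simp_rw [key]
    by_cases hr : r = 0
    · simp [hr, hP t d]
    · simp [hr]
  · intro p c hpc
    simp only [LinearMap.comp_apply] at hpc
    have e1 : N₁ ≤ c := by
      by_contra hc
      exact hpc (by
        rw [show P' c t = 0 from h₁ c (by omega), map_zero, map_zero, map_zero])
    have e2 : N₂ ≤ p := by
      by_contra hc
      exact hpc (by rw [(h₂ _ (m₁ c) p).2 (by omega), map_zero, map_zero])
    have e3 : N₃ ≤ r - p := by
      by_contra hc
      exact hpc (by rw [(h₃ _ (h₂ _ (m₁ c) p).1 _).2 (by omega), map_zero])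
    have e4 : N₄ ≤ d - c := by
      by_contra hc
      exact hpc ((h₄ _ (h₃ _ (h₂ _ (m₁ c) p).1 _).1 _).2 (by omega))
    simp only [Set.mem_Icc]
    omega

lemma IsLeftInverseFamily₂.swap {W : ℤ → ℤ → (B →ₗ[ℂ] A)} {W' : ℤ → ℤ → (A →ₗ[ℂ] B)}
    (h : IsLeftInverseFamily₂ W W') (hW : IsLaurentFamily₂ W) (hW' : IsLaurentFamily₂ W') :
    IsLeftInverseFamily₂ (fun p c => W c p) (fun p c => W' c p) := by
  intro t r d
  obtain ⟨F', hF', N', h'⟩ := hW' _ (Submodule.fg_span_singleton t)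
  replace h' := h' t (Submodule.mem_span_singleton_self t)
  obtain ⟨F'', -, N, h''⟩ := hW F' hF'
  rw [finsum_finsum_comm _ (Set.Icc N' (r - N)) (Set.Icc N' (d - N)) (Set.finite_Icc _ _)
    (Set.finite_Icc _ _), h t d r]
  · simp only [and_comm]
  · intro p c hpc
    have e1 : N' ≤ c ∧ N' ≤ p := by
      by_contra hc
      exact hpc (by rw [(h' c p).2 (by omega), map_zero])
    have e2 : N ≤ d - c ∧ N ≤ r - p := by
      by_contra hc
      exact hpc ((h'' _ (h' c p).1 _ _).2 (by omega))
    simp only [Set.mem_Icc]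
    omega

/-- The coefficient of `x₁^a x₂^b` in `W(x₁ + x₂, x₁) t`. -/
def substFamily (W : ℤ → ℤ → (A →ₗ[ℂ] B)) (a : ℤ) (b : ℕ) (t : A) : B :=
  ∑ᶠ p : ℤ, ((zchoose p b : ℤ) : ℂ) • W p (a - p + b) t

lemma substFamily_zero (W : ℤ → ℤ → (A →ₗ[ℂ] B)) (a : ℤ) (b : ℕ) : substFamily W a b 0 = 0 := by
  simp [substFamily]

lemma IsLaurentFamily₂.hasFiniteSupport_subst {W : ℤ → ℤ → (A →ₗ[ℂ] B)}
    (hW : IsLaurentFamily₂ W) (a : ℤ) (b : ℕ) (t : A) :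
    (fun p => ((zchoose p b : ℤ) : ℂ) • W p (a - p + b) t).HasFiniteSupport := by
  obtain ⟨F', -, N, h⟩ := hW _ (Submodule.fg_span_singleton t)
  refine hasFiniteSupport_int N (a + b - N) fun p hp => ?_
  rw [(h t (Submodule.mem_span_singleton_self t) p (a - p + b)).2 (by omega), smul_zero]

lemma IsLaurentFamily₂.exists_bound_subst {W : ℤ → ℤ → (A →ₗ[ℂ] B)} (hW : IsLaurentFamily₂ W)
    {F : Submodule ℂ A} (hF : F.FG) :
    ∃ F' : Submodule ℂ B, F'.FG ∧ ∃ N : ℤ, ∀ t ∈ F, ∀ (a : ℤ) (b : ℕ),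
      substFamily W a b t ∈ F' ∧ (a + b < N → substFamily W a b t = 0) := by
  obtain ⟨F', hF', N, h⟩ := hW F hF
  refine ⟨F', hF', N + N, fun t ht a b => ⟨?_, fun hab => ?_⟩⟩
  · exact finsum_induction (· ∈ F') F'.zero_mem (fun _ _ => F'.add_mem)
      fun p => F'.smul_mem _ (h t ht _ _).1
  · refine finsum_eq_zero_of_forall_eq_zero fun p => ?_
    rw [(h t ht p (a - p + b)).2 (by omega), smul_zero]

/-- Substitution of `x₁ + x₂` for `z` is multiplicative. -/
lemma IsLeftInverseFamily₂.subst {W : ℤ → ℤ → (B →ₗ[ℂ] A)} {W' : ℤ → ℤ → (A →ₗ[ℂ] B)}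
    (h : IsLeftInverseFamily₂ W W') (hW : IsLaurentFamily₂ W) (hW' : IsLaurentFamily₂ W')
    (t : A) (m : ℤ) (k : ℕ) :
    ∑ ij ∈ Finset.HasAntidiagonal.antidiagonal k,
      ∑ᶠ a : ℤ, substFamily W (m - a) ij.2 (substFamily W' a ij.1 t)
        = if m = 0 ∧ k = 0 then t else 0 := by
  obtain ⟨F', hF', N', h'⟩ := hW' _ (Submodule.fg_span_singleton t)
  replace h' := h' t (Submodule.mem_span_singleton_self t)
  obtain ⟨F'', -, N, h''⟩ := hW F' hF'
  let g : ℤ → ℤ → ℤ → A := fun s q c => W (s - q) (m + k - s - c) (W' q c t)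
  have hg : ∀ s q c, g s q c ≠ 0 → s ∈ Set.Icc (N + N') (m + k - N - N') ∧
      q ∈ Set.Icc N' (m + k - N' - N - N) ∧ c ∈ Set.Icc N' (m + k - N' - N - N) := by
    intro s q c hne
    have e1 : N' ≤ q ∧ N' ≤ c := by
      by_contra hc
      exact hne (by simp only [g]; rw [(h' q c).2 (by omega), map_zero])
    have e2 : N ≤ s - q ∧ N ≤ m + k - s - c := by
      by_contra hc
      exact hne ((h'' _ (h' q c).1 _ _).2 (by omega))
    simp only [Set.mem_Icc]
    omega
  have hfin : (Set.Icc (N + N') (m + k - N - N') ×ˢ (Set.Icc N' (m + k - N' - N - N) ×ˢ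
      Set.Icc N' (m + k - N' - N - N))).Finite :=
    (Set.finite_Icc _ _).prod ((Set.finite_Icc _ _).prod (Set.finite_Icc _ _))
  have hgs : ∀ r : ℤ → ℤ → ℂ,
      (fun x : ℤ × ℤ × ℤ => r x.1 x.2.1 • g x.1 x.2.1 x.2.2).HasFiniteSupport := fun r =>
    hasFiniteSupport_of_forall_mem _ hfin fun x hx =>
      hg _ _ _ fun h0 => hx (by simp only [h0, smul_zero])
  have term : ∀ ij ∈ Finset.HasAntidiagonal.antidiagonal k,
      ∑ᶠ a : ℤ, substFamily W (m - a) ij.2 (substFamily W' a ij.1 t)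
        = ∑ᶠ x : ℤ × ℤ × ℤ,
          ((zchoose (x.1 - x.2.1) ij.2 * zchoose x.2.1 ij.1 : ℤ) : ℂ) • g x.1 x.2.1 x.2.2 := by
    rintro ⟨j, i⟩ hij
    rw [Finset.HasAntidiagonal.mem_antidiagonal] at hij
    subst hij
    let e : ℤ × ℤ × ℤ ≃ ℤ × ℤ × ℤ :=
      { toFun := fun x => (x.2.1 + x.2.2, x.2.2, x.1 - x.2.2 + j)
        invFun := fun x => (x.2.2 + x.2.1 - j, x.1 - x.2.1, x.2.1)
        left_inv := fun x => by ext <;> (simp; try ring)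
        right_inv := fun x => by ext <;> (simp; try ring) }
    rw [← finsum_comp_equiv e, finsum_curry₃]
    · refine finsum_congr fun a => ?_
      unfold substFamily
      refine finsum_congr fun p => ?_
      rw [map_finsum _ (hW'.hasFiniteSupport_subst a j t), smul_finsum]
      refine finsum_congr fun q => ?_
      simp only [e, g, Equiv.coe_fn_mk, map_smul, smul_smul]
      push_cast
      rw [show p + q - q = p by ring,
        show m + (↑j + ↑i) - (p + q) - (a - q + ↑j) = m - a - p + ↑i by ring]
    · exact (hgs fun s q => ((zchoose (s - q) i * zchoose q j : ℤ) : ℂ)).preimage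
        e.injective.injOn
  rw [Finset.sum_congr rfl term, ← finsum_sum_comm _ _ fun ij _ =>
    hgs fun s q => ((zchoose (s - q) ij.2 * zchoose q ij.1 : ℤ) : ℂ)]
  simp_rw [← Finset.sum_smul, ← Int.cast_sum, sum_antidiagonal_zchoose_mul, sub_add_cancel]
  rw [finsum_curry₃ _ (hgs fun s _ => ((zchoose s k : ℤ) : ℂ))]
  simp_rw [← smul_finsum, g, h t]
  rw [finsum_eq_single _ 0 fun s hs => by rw [if_neg (by tauto), smul_zero]]
  simp only [zchoose_zero_left]
  by_cases hk : k = 0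
  · simp [hk]
  · simp [hk]

/-- If `R(x₁, x₂) = W(x₁ + x₂, x₁)` and `S(x₁)` are invertible, then `S(x₁) y(x₂) = y(x₂) R(x₁, x₂)`
implies `S(x₁)⁻¹ y(x₂) = y(x₂) R(x₁, x₂)⁻¹`. -/
lemma intertwine_inverse {W W' : ℤ → ℤ → (A →ₗ[ℂ] A)} {S S' : ℤ → (B →ₗ[ℂ] B)}
    {y : ℤ → (A →ₗ[ℂ] B)} (hW : IsLaurentFamily₂ W) (hW' : IsLaurentFamily₂ W')
    (hWW' : IsLeftInverseFamily₂ W W') (hS : IsLaurentFamily S) (hS' : IsLaurentFamily S')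
    (hSS : IsLeftInverseFamily S' S)
    (hy : ∀ F : Submodule ℂ A, F.FG → ∃ N : ℤ, ∀ t ∈ F, ∀ n < N, y n t = 0)
    (hex : ∀ t m n, S m (y n t) = ∑ᶠ i : ℕ, y (n - i) (substFamily W m i t))
    (t : A) (m n : ℤ) :
    S' m (y n t) = ∑ᶠ i : ℕ, y (n - i) (substFamily W' m i t) := by
  have ht := Submodule.mem_span_singleton_self (R := ℂ) t
  obtain ⟨F', hF', N', h'⟩ := hW'.exists_bound_subst (Submodule.fg_span_singleton t)
  replace h' := h' t ht
  obtain ⟨F'', hF'', N'', h''⟩ := hW.exists_bound_subst hF'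
  obtain ⟨M₁, hM₁⟩ := hy F' hF'
  obtain ⟨M₂, hM₂⟩ := hy F'' hF''
  obtain ⟨L, hL₁, hL₂, hL₀⟩ : ∃ L : ℕ, n - L < M₁ ∧ n - L < M₂ ∧ 0 < L :=
    ⟨(n - M₁).toNat + (n - M₂).toNat + 1, by omega, by omega, by omega⟩
  set u : ℤ → B := fun a => ∑ᶠ i : ℕ, y (n - i) (substFamily W' a i t) with hu
  have usum : ∀ a, u a = ∑ i ∈ Finset.range L, y (n - i) (substFamily W' a i t) := fun a =>
    finsum_eq_finsetSum_of_support_subset _ fun i hi => by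
      by_contra hc
      simp only [Finset.coe_range, Set.mem_Iio, not_lt] at hc
      exact hi (hM₁ _ (h' a i).1 _ (by omega))
  have hutl : IsTensorLaurent u := by
    refine ⟨⟨N' - L, fun a ha => ?_⟩, ⨆ i ∈ Finset.range L, F'.map (y (n - i)), ?_, fun a => ?_⟩
    · rw [usum]
      refine Finset.sum_eq_zero fun i hi => ?_
      rw [Finset.mem_range] at hi
      rw [(h' a i).2 (by omega), map_zero]
    · exact Submodule.fg_biSup _ _ fun i _ => hF'.map _
    · rw [usum]
      exact Submodule.sum_mem _ fun i hi =>
        Submodule.mem_iSup_of_mem i (Submodule.mem_iSup_of_mem hi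
          (Submodule.mem_map_of_mem (h' a i).1))
  have key : ∀ a, ∑ᶠ e : ℤ, S (a - e) (u e) = if a = 0 then y n t else 0 := by
    intro a
    let g : ℤ → ℕ → ℕ → B := fun e i j =>
      y (n - (i + j : ℕ)) (substFamily W (a - e) j (substFamily W' e i t))
    have hg : ∀ e i j, g e i j ≠ 0 →
        e ∈ Set.Icc (N' - L) (a + L - N'') ∧ i ∈ Set.Iio L ∧ j ∈ Set.Iio L := by
      intro e i j hne
      have e1 : i + j < L := by
        by_contra hc
        exact hne (hM₂ _ (h'' _ (h' e i).1 _ _).1 _ (by omega))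
      have e2 : N' ≤ e + i := by
        by_contra hc
        refine hne ?_
        simp only [g]
        rw [(h' e i).2 (by omega), substFamily_zero, map_zero]
      have e3 : N'' ≤ a - e + j := by
        by_contra hc
        refine hne ?_
        simp only [g]
        rw [(h'' _ (h' e i).1 _ _).2 (by omega), map_zero]
      simp only [Set.mem_Icc, Set.mem_Iio]
      omega
    have inner : ∀ e, S (a - e) (u e) = ∑ᶠ (i : ℕ) (j : ℕ), g e i j := by
      intro e
      rw [hu, map_finsum]
      · refine finsum_congr fun i => ?_
        rw [hex]
        refine finsum_congr fun j => ?_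
        simp only [g]
        push_cast
        rw [sub_sub]
      · refine hasFiniteSupport_of_forall_mem (Set.Iio L) (Set.finite_Iio L) fun i hi => ?_
        by_contra hc
        simp only [Set.mem_Iio, not_lt] at hc
        exact hi (hM₁ _ (h' e i).1 _ (by omega))
    simp_rw [inner]
    rw [finsum_finsum_comm _ (Set.Icc (N' - L) (a + L - N'')) (Set.Iio L) (Set.finite_Icc _ _)
      (Set.finite_Iio _)]
    · have swap : ∀ i, ∑ᶠ (e : ℤ) (j : ℕ), g e i j = ∑ᶠ (j : ℕ) (e : ℤ), g e i j := fun i =>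
        finsum_finsum_comm _ (Set.Icc (N' - L) (a + L - N'')) (Set.Iio L) (Set.finite_Icc _ _)
          (Set.finite_Iio _) fun e j hne => ⟨(hg e i j hne).1, (hg e i j hne).2.2⟩
      simp_rw [swap]
      rw [finsum_finsum_nat_eq_sum_antidiagonal _ L]
      · have coeff : ∀ k, ∑ ij ∈ Finset.HasAntidiagonal.antidiagonal k, ∑ᶠ e : ℤ, g e ij.1 ij.2
            = if k = 0 then (if a = 0 then y n t else 0) else 0 := by
          intro k
          have hk : ∀ ij ∈ Finset.HasAntidiagonal.antidiagonal k, ∑ᶠ e : ℤ, g e ij.1 ij.2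
              = y (n - k) (∑ᶠ e : ℤ, substFamily W (a - e) ij.2 (substFamily W' e ij.1 t)) := by
            intro ij hij
            rw [Finset.HasAntidiagonal.mem_antidiagonal] at hij
            rw [map_finsum]
            · exact finsum_congr fun e => by simp only [g, hij]
            · refine hasFiniteSupport_int (N' - ij.1) (a + ij.2 - N'') fun e he => ?_
              rcases he with he | he
              · rw [(h' e _).2 (by omega), substFamily_zero]
              · exact (h'' _ (h' e _).1 _ _).2 (by omega)
          rw [Finset.sum_congr rfl hk, ← map_sum, hWW'.subst hW hW' t a k]
          split_ifs <;> simp_all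
        simp_rw [coeff]
        rw [Finset.sum_ite_eq' _ _ _, if_pos (Finset.mem_range.2 hL₀)]
      · intro i j hij
        refine finsum_eq_zero_of_forall_eq_zero fun e => ?_
        exact hM₂ _ (h'' _ (h' e i).1 _ _).1 _ (by push_cast; omega)
    · intro e i hne
      obtain ⟨j, hj⟩ : ∃ j, g e i j ≠ 0 := by
        by_contra! hc
        exact hne (finsum_eq_zero_of_forall_eq_zero hc)
      exact ⟨(hg e i j hj).1, (hg e i j hj).2.1⟩
  have := hSS.conv_conv hS' hS hutl m
  simp_rw [key] at this
  change _ = u m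
  rw [← this, finsum_eq_single _ 0 fun a ha => by rw [if_neg ha, map_zero]]
  simp

end OperatorFamilies

section Flip

variable {V : Type*} [AddCommGroup V] [Module ℂ V]

/-- The coefficients of `S²¹(-x)`. -/
def S21neg (Sc : ℤ → (V ⊗[ℂ] V →ₗ[ℂ] V ⊗[ℂ] V)) (c : ℤ) : V ⊗[ℂ] V →ₗ[ℂ] V ⊗[ℂ] V :=
  ((-1 : ℂ) ^ c) • S21c Sc c

variable {Sc T : ℤ → (V ⊗[ℂ] V →ₗ[ℂ] V ⊗[ℂ] V)}

lemma neg_one_zpow_mul_self (n : ℤ) : (-1 : ℂ) ^ n * (-1 : ℂ) ^ n = 1 := by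
  rw [← mul_zpow]
  simp

lemma neg_one_zpow_sub (m n : ℤ) : (-1 : ℂ) ^ (m - n) = (-1) ^ m * (-1) ^ n := by
  rw [sub_eq_add_neg, zpow_add₀ (by norm_num), zpow_neg, ← inv_zpow]
  norm_num

lemma S21neg_apply (c : ℤ) (t : V ⊗[ℂ] V) :
    S21neg Sc c t = ((-1 : ℂ) ^ c) • TensorProduct.comm ℂ V V (Sc c (TensorProduct.comm ℂ V V t)) :=
  rfl

lemma comm_comm_apply (t : V ⊗[ℂ] V) :
    TensorProduct.comm ℂ V V (TensorProduct.comm ℂ V V t) = t :=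
  (TensorProduct.comm ℂ V V).symm_apply_apply t

lemma IsLaurentFamily.S21neg (h : IsLaurentFamily Sc) : IsLaurentFamily (S21neg Sc) := by
  intro t
  obtain ⟨⟨N, hN⟩, F, hF, hm⟩ := h.conj (TensorProduct.comm ℂ V V).toLinearMap
    (TensorProduct.comm ℂ V V).toLinearMap t
  refine ⟨⟨N, fun n hn => ?_⟩, F, hF, fun n => F.smul_mem _ (hm n)⟩
  exact (congrArg (fun x => ((-1 : ℂ) ^ n) • x) (hN n hn)).trans (smul_zero _)

lemma Unitary.isLeftInverseFamily (h : Unitary Sc) : IsLeftInverseFamily Sc (S21neg Sc) := by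
  intro t n
  rw [← h t n, ← finsum_comp_equiv (Equiv.subLeft n)]
  refine finsum_congr fun c => ?_
  simp [_root_.S21neg]

lemma Unitary.isLeftInverseFamily_S21neg (h : Unitary Sc) :
    IsLeftInverseFamily (S21neg Sc) Sc := by
  intro t n
  let σ := TensorProduct.comm ℂ V V
  have key : ∀ c, S21neg Sc (n - c) (Sc c t)
      = ((-1 : ℂ) ^ n) • σ (Sc (n - c) (S21neg Sc c (σ t))) := by
    intro c
    simp only [σ, S21neg_apply, comm_comm_apply, map_smul, smul_smul, neg_one_zpow_sub]
  simp_rw [key, ← smul_finsum]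
  rw [← AddEquivClass.map_finsum σ, h.isLeftInverseFamily (σ t) n]
  split_ifs with hn
  · simp [hn, σ]
  · simp

lemma IsLeftInverseFamily.apply_eq_of_apply_eq (h : IsLeftInverseFamily T Sc) {t : V ⊗[ℂ] V}
    (hS : ∀ n, Sc n t = if n = 0 then t else 0) (n : ℤ) :
    T n t = if n = 0 then t else 0 := by
  rw [← h t n, finsum_eq_single _ 0 fun c hc => by rw [hS, if_neg hc, map_zero]]
  simp [hS]

lemma swap23_comp_swap23 : (swap23 (V := V)).comp swap23 = LinearMap.id := by
  ext a b c
  simp [swap23]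

lemma S23m_eq_conj (c : ℤ) : S23m Sc c =
    ((TensorProduct.assoc ℂ V V V).symm.toLinearMap ∘ₗ
        (TensorProduct.comm ℂ (V ⊗[ℂ] V) V).toLinearMap) ∘ₗ
      S12m Sc c ∘ₗ ((TensorProduct.comm ℂ V (V ⊗[ℂ] V)).toLinearMap ∘ₗ
        (TensorProduct.assoc ℂ V V V).toLinearMap) := by
  ext a b c
  simp [S23m, S12m]

lemma IsLaurentFamily.S12m (h : IsLaurentFamily Sc) : IsLaurentFamily (S12m Sc) := h.rTensor

lemma IsLaurentFamily.S13m (h : IsLaurentFamily Sc) : IsLaurentFamily (S13m Sc) :=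
  h.S12m.conj swap23 swap23

lemma IsLaurentFamily.S23m (h : IsLaurentFamily Sc) : IsLaurentFamily (S23m Sc) := by
  rw [funext (S23m_eq_conj (Sc := Sc))]
  exact h.S12m.conj _ _

lemma IsLeftInverseFamily.S13m (h : IsLeftInverseFamily Sc T) (hS : IsLaurentFamily Sc)
    (hT : IsLaurentFamily T) : IsLeftInverseFamily (S13m Sc) (S13m T) :=
  IsLeftInverseFamily.conj (h.rTensor hS hT) hS.S12m hT.S12m swap23_comp_swap23 swap23_comp_swap23

lemma IsLeftInverseFamily.S23m (h : IsLeftInverseFamily Sc T) (hS : IsLaurentFamily Sc)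
    (hT : IsLaurentFamily T) : IsLeftInverseFamily (S23m Sc) (S23m T) := by
  rw [funext (S23m_eq_conj (Sc := Sc)), funext (S23m_eq_conj (Sc := T))]
  refine IsLeftInverseFamily.conj (h.rTensor hS hT) hS.S12m hT.S12m ?_ ?_
  · ext a b c
    simp
  · ext a b c
    simp

/-- The cyclic permutation `a ⊗ b ⊗ c ↦ c ⊗ a ⊗ b`. -/
def cycle : (V ⊗[ℂ] V) ⊗[ℂ] V ≃ₗ[ℂ] (V ⊗[ℂ] V) ⊗[ℂ] V :=
  (TensorProduct.comm ℂ (V ⊗[ℂ] V) V).trans (TensorProduct.assoc ℂ V V V).symm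

lemma cycle_S13m_S21neg (p : ℤ) (t : (V ⊗[ℂ] V) ⊗[ℂ] V) :
    cycle (S13m (S21neg Sc) p t) = ((-1 : ℂ) ^ p) • S12m Sc p (cycle t) := by
  have aux : ∀ (X : V ⊗[ℂ] V) (b : V),
      cycle (swap23 ((TensorProduct.comm ℂ V V X) ⊗ₜ b)) = X ⊗ₜ[ℂ] b := by
    intro X b
    induction X using TensorProduct.induction_on with
    | zero => simp
    | tmul x y => simp [cycle, swap23]
    | add x y hx hy => simp only [map_add, TensorProduct.add_tmul, hx, hy]
  suffices h : cycle.toLinearMap ∘ₗ S13m (S21neg Sc) p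
      = ((-1 : ℂ) ^ p) • S12m Sc p ∘ₗ cycle.toLinearMap from LinearMap.congr_fun h t
  ext a b c
  have e1 : swap23 ((a ⊗ₜ[ℂ] b) ⊗ₜ[ℂ] c) = (a ⊗ₜ c) ⊗ₜ b := by simp [swap23]
  have e2 : cycle ((a ⊗ₜ[ℂ] b) ⊗ₜ[ℂ] c) = (c ⊗ₜ a) ⊗ₜ b := by simp [cycle]
  simp [S13m, S12m, e1, e2, S21neg_apply, ← TensorProduct.smul_tmul', aux]

lemma cycle_S23m_S21neg (p : ℤ) (t : (V ⊗[ℂ] V) ⊗[ℂ] V) :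
    cycle (S23m (S21neg Sc) p t) = ((-1 : ℂ) ^ p) • S13m Sc p (cycle t) := by
  have aux : ∀ (X : V ⊗[ℂ] V) (a : V),
      cycle ((TensorProduct.assoc ℂ V V V).symm (a ⊗ₜ (TensorProduct.comm ℂ V V X)))
        = swap23 (X ⊗ₜ[ℂ] a) := by
    intro X a
    induction X using TensorProduct.induction_on with
    | zero => simp
    | tmul x y => simp [cycle, swap23]
    | add x y hx hy => simp only [map_add, TensorProduct.add_tmul, TensorProduct.tmul_add, hx, hy]
  suffices h : cycle.toLinearMap ∘ₗ S23m (S21neg Sc) p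
      = ((-1 : ℂ) ^ p) • S13m Sc p ∘ₗ cycle.toLinearMap from LinearMap.congr_fun h t
  ext a b c
  have e1 : swap23 ((c ⊗ₜ[ℂ] a) ⊗ₜ[ℂ] b) = (c ⊗ₜ b) ⊗ₜ a := by simp [swap23]
  have e2 : cycle ((a ⊗ₜ[ℂ] b) ⊗ₜ[ℂ] c) = (c ⊗ₜ a) ⊗ₜ b := by simp [cycle]
  simp [S13m, S12m, S23m, e1, e2, S21neg_apply, aux]

/-- The coefficients of `Y(x) ⊗ 1`. -/
def Ytensor (𝒱 : NLVA V) (n : ℤ) : (V ⊗[ℂ] V) ⊗[ℂ] V →ₗ[ℂ] V ⊗[ℂ] V :=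
  TensorProduct.map (TensorProduct.lift (𝒱.Yc n)) LinearMap.id

lemma Ytensor_eq_comm (𝒱 : NLVA V) (n : ℤ) (t : (V ⊗[ℂ] V) ⊗[ℂ] V) :
    Ytensor 𝒱 n t = TensorProduct.comm ℂ V V ((LinearMap.lTensor V (TensorProduct.lift (𝒱.Yc n)))
      (TensorProduct.assoc ℂ V V V (cycle t))) := by
  suffices h : Ytensor 𝒱 n = (TensorProduct.comm ℂ V V).toLinearMap ∘ₗ
      LinearMap.lTensor V (TensorProduct.lift (𝒱.Yc n)) ∘ₗ
      (TensorProduct.assoc ℂ V V V).toLinearMap ∘ₗ cycle.toLinearMap from LinearMap.congr_fun h t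
  ext a b c
  simp [Ytensor, cycle]

lemma Ytensor_trunc (𝒱 : NLVA V) {F : Submodule ℂ ((V ⊗[ℂ] V) ⊗[ℂ] V)} (hF : F.FG) :
    ∃ N : ℤ, ∀ t ∈ F, ∀ n < N, Ytensor 𝒱 n t = 0 := by
  have lift_trunc : ∀ t : V ⊗[ℂ] V, ∃ N : ℤ, ∀ n < N, TensorProduct.lift (𝒱.Yc n) t = 0 := by
    intro t
    induction t using TensorProduct.induction_on with
    | zero => exact ⟨0, fun n _ => map_zero _⟩
    | tmul u v => exact 𝒱.trunc u v
    | add x y hx hy =>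
      obtain ⟨N₁, h₁⟩ := hx
      obtain ⟨N₂, h₂⟩ := hy
      exact ⟨min N₁ N₂, fun n hn => by
        rw [map_add, h₁ n (by omega), h₂ n (by omega), add_zero]⟩
  have single : ∀ t, ∃ N : ℤ, ∀ n < N, Ytensor 𝒱 n t = 0 := by
    intro t
    induction t using TensorProduct.induction_on with
    | zero => exact ⟨0, fun n _ => map_zero _⟩
    | tmul u v =>
      obtain ⟨N, h⟩ := lift_trunc u
      exact ⟨N, fun n hn => by simp [Ytensor, h n hn]⟩
    | add x y hx hy =>
      obtain ⟨N₁, h₁⟩ := hx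
      obtain ⟨N₂, h₂⟩ := hy
      exact ⟨min N₁ N₂, fun n hn => by
        rw [map_add, h₁ n (by omega), h₂ n (by omega), add_zero]⟩
  induction F, hF using Submodule.fg_induction with
  | singleton x =>
    obtain ⟨N, h⟩ := single x
    refine ⟨N, fun t ht n hn => ?_⟩
    obtain ⟨c, rfl⟩ := Submodule.mem_span_singleton.1 ht
    rw [map_smul, h n hn, smul_zero]
  | sup F₁ F₂ _ _ h₁ h₂ =>
    obtain ⟨N₁, h₁⟩ := h₁
    obtain ⟨N₂, h₂⟩ := h₂
    refine ⟨min N₁ N₂, fun t ht n hn => ?_⟩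
    obtain ⟨a, ha, b, hb, rfl⟩ := Submodule.mem_sup.1 ht
    rw [map_add, h₁ a ha n (by omega), h₂ b hb n (by omega), add_zero]

lemma apply_substFamily {A B C : Type*} [AddCommGroup A] [Module ℂ A] [AddCommGroup B] [Module ℂ B]
    [AddCommGroup C] [Module ℂ C] {W : ℤ → ℤ → (A →ₗ[ℂ] B)} (hW : IsLaurentFamily₂ W)
    (f : B →ₗ[ℂ] C) (a : ℤ) (b : ℕ) (t : A) :
    f (substFamily W a b t) = ∑ᶠ p : ℤ, ((zchoose p b : ℤ) : ℂ) • f (W p (a - p + b) t) := by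
  rw [substFamily, map_finsum f (hW.hasFiniteSupport_subst a b t)]
  simp only [map_smul]

lemma hexY1_iff (𝒱 : NLVA V) (hS : IsLaurentFamily Sc) :
    HexY1 𝒱 Sc ↔ ∀ t m n, Sc m (Ytensor 𝒱 n t)
      = ∑ᶠ i : ℕ, Ytensor 𝒱 (n - i) (substFamily (fun p c => S23m Sc c ∘ₗ S13m Sc p) m i t) := by
  simp_rw [apply_substFamily (hS.S23m.comp hS.S13m)]
  rfl

lemma hexY2_iff (𝒱 : NLVA V) (hS : IsLaurentFamily Sc) :
    HexY2 𝒱 Sc ↔ ∀ t m n, S21neg Sc m (Ytensor 𝒱 n t)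
      = ∑ᶠ i : ℕ, Ytensor 𝒱 (n - i)
        (substFamily (fun p c => S13m (S21neg Sc) p ∘ₗ S23m (S21neg Sc) c) m i t) := by
  simp_rw [apply_substFamily (hS.S21neg.S13m.comp hS.S21neg.S23m).swap]
  unfold HexY2
  refine cycle.surjective.forall.trans (forall_congr' fun t => forall_congr' fun m =>
    forall_congr' fun n => ?_)
  have lhs : S21neg Sc m (Ytensor 𝒱 n t) = ((-1 : ℂ) ^ m) • TensorProduct.comm ℂ V V
      (Sc m ((LinearMap.lTensor V (TensorProduct.lift (𝒱.Yc n)))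
        (TensorProduct.assoc ℂ V V V (cycle t)))) := by
    rw [S21neg_apply, Ytensor_eq_comm, comm_comm_apply]
  have rhs : ∀ (i : ℕ) (p : ℤ), ((zchoose p i : ℤ) : ℂ) • Ytensor 𝒱 (n - i)
        ((S13m (S21neg Sc) p ∘ₗ S23m (S21neg Sc) (m - p + i)) t)
      = ((-1 : ℂ) ^ m) • TensorProduct.comm ℂ V V (((-1 : ℂ) ^ i * ((zchoose p i : ℤ) : ℂ)) •
          (LinearMap.lTensor V (TensorProduct.lift (𝒱.Yc (n - i))))
            ((TensorProduct.assoc ℂ V V V)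
              (S12m Sc p (S13m Sc (m - p + i) (cycle t))))) := by
    intro i p
    rw [Ytensor_eq_comm, LinearMap.comp_apply, cycle_S13m_S21neg, cycle_S23m_S21neg]
    simp only [map_smul, smul_smul]
    congr 1
    rw [zpow_add₀ (by norm_num), neg_one_zpow_sub, zpow_natCast]
    linear_combination (((zchoose p i : ℤ) : ℂ) * (-1) ^ m * (-1) ^ i) * neg_one_zpow_mul_self p
  rw [lhs]
  simp_rw [rhs, ← smul_finsum, ← AddEquivClass.map_finsum]
  rw [smul_right_inj (zpow_ne_zero m (by norm_num : (-1 : ℂ) ≠ 0)),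
    (TensorProduct.comm ℂ V V).injective.eq_iff]

lemma Unitary.apply_comm_eq (h : Unitary Sc) {t : V ⊗[ℂ] V}
    (ht : ∀ n, Sc n t = if n = 0 then t else 0) (n : ℤ) :
    Sc n (TensorProduct.comm ℂ V V t) = if n = 0 then TensorProduct.comm ℂ V V t else 0 := by
  have key := congrArg (TensorProduct.comm ℂ V V)
    (h.isLeftInverseFamily_S21neg.apply_eq_of_apply_eq ht n)
  rw [S21neg_apply, map_smul, comm_comm_apply] at key
  replace key := congrArg (fun x => ((-1 : ℂ) ^ n) • x) key
  simp only [smul_smul, neg_one_zpow_mul_self, one_smul] at key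
  rw [key]
  split_ifs with hn <;> simp [hn]

lemma dcomm1_iff (𝒱 : NLVA V) (Sc : ℤ → (V ⊗[ℂ] V →ₗ[ℂ] V ⊗[ℂ] V)) :
    DComm1 𝒱 Sc ↔ ∀ (t : V ⊗[ℂ] V) (n : ℤ),
      (LinearMap.lTensor V 𝒱.D) (((-1 : ℂ) ^ n) • S21c Sc n t)
          - ((-1 : ℂ) ^ n) • S21c Sc n ((LinearMap.lTensor V 𝒱.D) t)
        = ((n : ℂ) + 1) • (((-1 : ℂ) ^ (n + 1)) • S21c Sc (n + 1) t) := by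
  have comm_D : ∀ t, LinearMap.lTensor V 𝒱.D (TensorProduct.comm ℂ V V t)
      = TensorProduct.comm ℂ V V (LinearMap.rTensor V 𝒱.D t) := fun t => by
    induction t using TensorProduct.induction_on with
    | zero => simp
    | tmul x y => simp
    | add x y hx hy => simp only [map_add, hx, hy]
  refine ((TensorProduct.comm ℂ V V).surjective.forall.trans
    (forall_congr' fun t => forall_congr' fun n => ?_)).symm
  have e : ∀ (k : ℤ) (s : V ⊗[ℂ] V), S21c Sc k (TensorProduct.comm ℂ V V s)
      = TensorProduct.comm ℂ V V (Sc k s) := fun k s =>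
    congrArg (fun x => TensorProduct.comm ℂ V V (Sc k x)) (comm_comm_apply s)
  rw [comm_D, e, e, e, map_smul, comm_D, ← smul_sub, ← map_sub, smul_smul,
    zpow_add_one₀ (by norm_num), show ((n : ℂ) + 1) * ((-1) ^ n * -1) = (-1) ^ n * -((n : ℂ) + 1)
      by ring, mul_smul, ← map_smul _ (-((n : ℂ) + 1)), ← map_smul, ← map_smul,
    (TensorProduct.comm ℂ V V).injective.eq_iff,
    smul_right_inj (zpow_ne_zero n (by norm_num : (-1 : ℂ) ≠ 0))]

end Flip

/-- Equivalences of axioms for a unitary rational quantum Yang–Baxter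
operator on a nonlocal vertex algebra (Lemma 3.6). -/
theorem statement_11 {V : Type*} [AddCommGroup V] [Module ℂ V]
    (𝒱 : NLVA V) (Sc : ℤ → (V ⊗[ℂ] V →ₗ[ℂ] V ⊗[ℂ] V))
    (hlaurent : ∀ t : V ⊗[ℂ] V, IsTensorLaurent fun n => Sc n t)
    (hqybe : QYBE Sc) (hunit : Unitary Sc) :
    ((∀ (v : V) (n : ℤ), Sc n (𝒱.one ⊗ₜ v) = if n = 0 then 𝒱.one ⊗ₜ v else 0)
      ↔ (∀ (v : V) (n : ℤ), Sc n (v ⊗ₜ 𝒱.one) = if n = 0 then v ⊗ₜ 𝒱.one else 0)) ∧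
    (DComm1 𝒱 Sc ↔
      (∀ (t : V ⊗[ℂ] V) (n : ℤ),
        (LinearMap.lTensor V 𝒱.D) (((-1 : ℂ) ^ n) • S21c Sc n t)
            - ((-1 : ℂ) ^ n) • S21c Sc n ((LinearMap.lTensor V 𝒱.D) t)
          = ((n : ℂ) + 1) • (((-1 : ℂ) ^ (n + 1)) • S21c Sc (n + 1) t))) ∧
    (HexY1 𝒱 Sc ↔ HexY2 𝒱 Sc) := by
  have hS : IsLaurentFamily Sc := hlaurent
  have hL := hunit.isLeftInverseFamily
  have hR := hunit.isLeftInverseFamily_S21neg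
  have hW := hS.S23m.comp hS.S13m
  have hW' := (hS.S21neg.S13m.comp hS.S21neg.S23m).swap
  have hWW' := IsLeftInverseFamily.comp (hL.S23m hS hS.S21neg) (hL.S13m hS hS.S21neg)
    hS.S23m hS.S21neg.S23m hS.S13m hS.S21neg.S13m
  have hW'W := (IsLeftInverseFamily.comp (hR.S13m hS.S21neg hS) (hR.S23m hS.S21neg hS)
    hS.S21neg.S13m hS.S13m hS.S21neg.S23m hS.S23m).swap
    (hS.S21neg.S13m.comp hS.S21neg.S23m) (hS.S23m.comp hS.S13m).swap
  refine ⟨⟨fun h v => hunit.apply_comm_eq fun n => h v n,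
    fun h v => hunit.apply_comm_eq fun n => h v n⟩, dcomm1_iff 𝒱 Sc, ?_⟩
  rw [hexY1_iff 𝒱 hS, hexY2_iff 𝒱 hS]
  exact ⟨intertwine_inverse hW hW' hWW' hS hS.S21neg hR fun F hF => Ytensor_trunc 𝒱 hF,
    intertwine_inverse hW' hW hW'W hS.S21neg hS hL fun F hF => Ytensor_trunc 𝒱 hF⟩
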